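/- Let n, m ≥ 1, let a < b be real numbers, let λ ∈ ℝ, and let B0, B1 : [a,b] → ℂ^{2n×2n} be continuous with B0(x) and B1(x) Hermitian for every x ∈ [a,b]. Suppose X, Y : [a,b] → ℂ^{2n×m} are differentiable with J X'(x) = (B0(x) + λ B1(x)) X(x) and J Y'(x) = (B0(x) + λ B1(x)) Y(x) + B1(x) X(x) for all x ∈ [a,b], and Y(a) = 0. Then for every x ∈ [a,b], X(x)* J Y(x) = ∫_a^x X(ξ)* B1(ξ) X(ξ) dξ. (Applied with Y = ∂_λ X, this gives X(x;λ)* J ∂_λX(x;λ) = ∫_a^x X(ξ;λ)* B1(ξ) X(ξ;λ) dξ when X(a;λ) is independent of λ.) -/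

import Mathlib

open Matrix Set

noncomputable section

/-- The standard `2n × 2n` complex symplectic matrix `J = [[0, -I],[I, 0]]`. -/
def stdJ (n : ℕ) : Matrix (Fin n ⊕ Fin n) (Fin n ⊕ Fin n) ℂ :=
  Matrix.fromBlocks 0 (-1) 1 0

/-- The symplectic matrix is skew-Hermitian. -/
theorem stdJ_conjTranspose (n : ℕ) : (stdJ n)ᴴ = -stdJ n := by
  simp [stdJ, Matrix.fromBlocks_conjTranspose, Matrix.fromBlocks_neg]

/-- Entrywise product rule for matrix-valued functions. -/
theorem hasDerivWithinAt_matrix_mul_apply {l k p : Type*} [Fintype k] {s : Set ℝ} {x : ℝ}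
    {F : ℝ → Matrix l k ℂ} {G : ℝ → Matrix k p ℂ} {F' : Matrix l k ℂ} {G' : Matrix k p ℂ}
    (hF : ∀ i j, HasDerivWithinAt (fun t => F t i j) (F' i j) s x)
    (hG : ∀ i j, HasDerivWithinAt (fun t => G t i j) (G' i j) s x) (i : l) (j : p) :
    HasDerivWithinAt (fun t => (F t * G t) i j) ((F' * G x + F x * G') i j) s x := by
  simp only [Matrix.mul_apply, Matrix.add_apply, ← Finset.sum_add_distrib]
  exact HasDerivWithinAt.fun_sum fun r _ => (hF i r).mul (hG r j)

/-- Entrywise continuity of a product of matrix-valued functions. -/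
theorem continuousOn_matrix_mul_apply {l k p : Type*} [Fintype k] {s : Set ℝ}
    {F : ℝ → Matrix l k ℂ} {G : ℝ → Matrix k p ℂ}
    (hF : ∀ i j, ContinuousOn (fun t => F t i j) s)
    (hG : ∀ i j, ContinuousOn (fun t => G t i j) s) (i : l) (j : p) :
    ContinuousOn (fun t => (F t * G t) i j) s := by
  simp only [Matrix.mul_apply]
  exact continuousOn_finsetSum _ fun r _ => (hF i r).mul (hG r j)

/-- The pointwise Lagrange identity: if `A` is Hermitian, `J V' = A V` and `J W' = A W + R`,
then `(Vᴴ J W)' = Vᴴ R`. -/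
theorem lagrange_identity {n m : ℕ} {A : Matrix (Fin n ⊕ Fin n) (Fin n ⊕ Fin n) ℂ}
    (hA : A.IsHermitian) {V W V' W' R : Matrix (Fin n ⊕ Fin n) (Fin m) ℂ}
    (hV : stdJ n * V' = A * V) (hW : stdJ n * W' = A * W + R) :
    V'ᴴ * (stdJ n * W) + Vᴴ * (stdJ n * W') = Vᴴ * R := by
  have h : V'ᴴ * stdJ n = -(Vᴴ * A) := by
    have h' := congrArg Matrix.conjTranspose hV
    rw [Matrix.conjTranspose_mul, Matrix.conjTranspose_mul, stdJ_conjTranspose, hA.eq,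
      Matrix.mul_neg] at h'
    rw [← h', neg_neg]
  rw [← Matrix.mul_assoc, h, hW, Matrix.mul_add, Matrix.neg_mul, Matrix.mul_assoc,
    neg_add_cancel_left]

/-- Monotonicity identity in the spectral parameter: if `J X' = (B0 + λ B1) X` and
`J Y' = (B0 + λ B1) Y + B1 X` on `[a,b]` with `Y(a) = 0`, then
`X(x)ᴴ J Y(x) = ∫ₐˣ X(ξ)ᴴ B1(ξ) X(ξ) dξ` (entrywise). -/
theorem spectral_monotonicity_identity
    (n m : ℕ) (hn : 1 ≤ n) (hm : 1 ≤ m) (a b : ℝ) (hab : a < b) (lam : ℝ)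
    (B0 B1 : ℝ → Matrix (Fin n ⊕ Fin n) (Fin n ⊕ Fin n) ℂ)
    (hB0c : ∀ i j, ContinuousOn (fun x => B0 x i j) (Icc a b))
    (hB1c : ∀ i j, ContinuousOn (fun x => B1 x i j) (Icc a b))
    (hB0 : ∀ x ∈ Icc a b, (B0 x).IsHermitian)
    (hB1 : ∀ x ∈ Icc a b, (B1 x).IsHermitian)
    (X Y DX DY : ℝ → Matrix (Fin n ⊕ Fin n) (Fin m) ℂ)
    (hX : ∀ x ∈ Icc a b, ∀ i j,
      HasDerivWithinAt (fun t => X t i j) (DX x i j) (Icc a b) x)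
    (hY : ∀ x ∈ Icc a b, ∀ i j,
      HasDerivWithinAt (fun t => Y t i j) (DY x i j) (Icc a b) x)
    (hXode : ∀ x ∈ Icc a b, stdJ n * DX x = (B0 x + (lam : ℂ) • B1 x) * X x)
    (hYode : ∀ x ∈ Icc a b,
      stdJ n * DY x = (B0 x + (lam : ℂ) • B1 x) * Y x + B1 x * X x)
    (hYa : Y a = 0) :
    ∀ x ∈ Icc a b, ∀ i j,
      ((X x)ᴴ * stdJ n * Y x) i j = ∫ ξ in a..x, ((X ξ)ᴴ * B1 ξ * X ξ) i j := by
  intro x hx i j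
  have hderiv : ∀ t ∈ Icc a b, HasDerivWithinAt (fun t => ((X t)ᴴ * (stdJ n * Y t)) i j)
      (((X t)ᴴ * B1 t * X t) i j) (Icc a b) t := by
    intro t ht
    have hA : (B0 t + (lam : ℂ) • B1 t).IsHermitian :=
      (hB0 t ht).add ((hB1 t ht).smul (Complex.conj_ofReal lam))
    have hJY : ∀ k l, HasDerivWithinAt (fun t => (stdJ n * Y t) k l) ((stdJ n * DY t) k l)
        (Icc a b) t := fun k l => by
      simpa using hasDerivWithinAt_matrix_mul_apply (F := fun _ => stdJ n) (F' := 0)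
        (fun p q => hasDerivWithinAt_const t (Icc a b) (stdJ n p q)) (hY t ht) k l
    have hXH : ∀ k l, HasDerivWithinAt (fun t => (X t)ᴴ k l) ((DX t)ᴴ k l) (Icc a b) t :=
      fun k l => (hX t ht l k).star
    have h := hasDerivWithinAt_matrix_mul_apply hXH hJY i j
    rwa [lagrange_identity hA (hXode t ht) (hYode t ht), ← Matrix.mul_assoc] at h
  have hsub : Icc a x ⊆ Icc a b := Icc_subset_Icc_right hx.2
  have hXc : ∀ k l, ContinuousOn (fun t => X t k l) (Icc a b) :=
    fun k l t ht => (hX t ht k l).continuousWithinAt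
  have hint : ContinuousOn (fun t => ((X t)ᴴ * B1 t * X t) i j) (Icc a b) :=
    continuousOn_matrix_mul_apply
      (continuousOn_matrix_mul_apply (fun k l => (hXc l k).star) hB1c) hXc i j
  rw [intervalIntegral.integral_eq_sub_of_hasDerivAt_of_le hx.1
    (fun t ht => (hderiv t (hsub ht)).continuousWithinAt.mono hsub)
    (fun t ht => (hderiv t (hsub (Ioo_subset_Icc_self ht))).hasDerivAt
      (Icc_mem_nhds ht.1 (ht.2.trans_le hx.2)))
    ((hint.mono hsub).intervalIntegrable_of_Icc hx.1)]
  simp [hYa, Matrix.mul_assoc]
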